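/- arXiv:1707.01417 — 7 statements merged into one kernel-verified Lean document; each statement's English description precedes it below -/
import Mathlib

section
/- Let C be a finite set of candidates, let k ≤ |C|, and let s, s' : C → ℝ be two score assignments such that for some candidates a, b ∈ C we have s'(c) = s(c) for all c ∉ {a, b}, s'(a) ≥ s(a), and s'(b) ≤ s(b). Then for every size-k subset W of C that is winning under s, there exists a size-k subset W' of C that is winning under s' and satisfies |W ∩ W'| ≥ k − 1. -/
/-- A size-`k` committee `W` is winning under a score assignment `s` if every member of `W`
has score at least the score of every candidate outside `W`. -/
def ScoreWinning {C : Type*} (s : C → ℝ) (k : ℕ) (W : Finset C) : Prop :=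
  W.card = k ∧ ∀ a ∈ W, ∀ b ∉ W, s b ≤ s a

/-- Exchanging a lowest-scoring member of `W` for a strictly better highest-scoring candidate
outside `W` yields a winning committee, provided the only comparisons that may fail for `W`
involve the member `b` or the outsider `a`. -/
lemma scoreWinning_exchange {C : Type*} [DecidableEq C] {k : ℕ} {s : C → ℝ} {a b x y : C}
    {W : Finset C} (hcard : W.card = k) (hx : x ∈ W) (hy : y ∉ W)
    (hmin : ∀ w ∈ W, s x ≤ s w) (hmax : ∀ o ∉ W, s o ≤ s y) (hxy : s x < s y)
    (h : ∀ w ∈ W, ∀ o ∉ W, w ≠ b → o ≠ a → s o ≤ s w) :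
    ScoreWinning s k (insert y (W.erase x)) := by
  refine ⟨?_, fun w hw o ho => ?_⟩
  · rw [Finset.card_insert_of_notMem (fun hm => hy (Finset.mem_of_mem_erase hm)),
      Finset.card_erase_add_one hx, hcard]
  · simp only [Finset.mem_insert, Finset.mem_erase, not_or, not_and] at hw ho
    obtain ⟨hoy, ho⟩ := ho
    by_cases hox : o = x
    · subst hox
      rcases hw with rfl | ⟨-, hw⟩
      · exact hxy.le
      · exact hmin w hw
    · have hoW := ho hox
      rcases hw with rfl | ⟨hwx, hw⟩
      · exact hmax o hoW
      · by_cases hwb : w = b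
        · have hxb : x ≠ b := fun hxb => hwx (hwb.trans hxb.symm)
          by_cases hoa : o = a
          · have hya : y ≠ a := fun hya => hoy (hoa.trans hya.symm)
            exact absurd (h x hx y hy hxb hya) hxy.not_ge
          · exact (h x hx o hoW hxb hoa).trans (hmin w hw)
        · by_cases hoa : o = a
          · have hya : y ≠ a := fun hya => hoy (hoa.trans hya.symm)
            exact (hmax o hoW).trans (h w hw y hy hwb hya)
          · exact h w hw o hoW hwb hoa

theorem statement0 {C : Type*} [Fintype C] [DecidableEq C]
    (k : ℕ) (hk : k ≤ Fintype.card C)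
    (s s' : C → ℝ) (a b : C)
    (hother : ∀ c : C, c ≠ a → c ≠ b → s' c = s c)
    (ha : s a ≤ s' a) (hb : s' b ≤ s b)
    (W : Finset C) (hW : ScoreWinning s k W) :
    ∃ W' : Finset C, ScoreWinning s' k W' ∧ k - 1 ≤ (W ∩ W').card := by
  obtain ⟨hcard, hwin⟩ := hW
  by_cases hW' : ScoreWinning s' k W
  · exact ⟨W, hW', by simp [hcard]⟩
  have hviol : ∃ w ∈ W, ∃ o ∉ W, s' w < s' o := by
    by_contra! hcon
    exact hW' ⟨hcard, hcon⟩
  obtain ⟨w, hw, o, ho, hwo⟩ := hviol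
  obtain ⟨x, hx, hmin⟩ := W.exists_min_image s' ⟨w, hw⟩
  obtain ⟨y, hy, hmax⟩ := Wᶜ.exists_max_image s' ⟨o, Finset.mem_compl.2 ho⟩
  simp only [Finset.mem_compl] at hy hmax
  have hxy : s' x < s' y := (hmin w hw).trans_lt (hwo.trans_le (hmax o ho))
  have hraise : ∀ c, c ≠ b → s c ≤ s' c := fun c hc => by
    by_cases hca : c = a
    · exact hca ▸ ha
    · exact (hother c hca hc).ge
  have hlower : ∀ c, c ≠ a → s' c ≤ s c := fun c hc => by
    by_cases hcb : c = b
    · exact hcb ▸ hb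
    · exact (hother c hc hcb).le
  refine ⟨insert y (W.erase x), scoreWinning_exchange (a := a) (b := b) hcard hx hy hmin hmax hxy
    fun c hc d hd hcb hda => (hlower d hda).trans ((hwin c hc d hd).trans (hraise c hcb)), ?_⟩
  rw [← hcard, ← Finset.card_erase_of_mem hx]
  exact Finset.card_le_card
    (Finset.subset_inter (Finset.erase_subset x W) (Finset.subset_insert y _))
end

section
/- Let k ≥ 1 and let R be any multiwinner rule that is Gehrlein weakly-stable, i.e., whenever an election admits at least one Gehrlein weakly-stable size-k committee, R(E,k) equals the set of all Gehrlein weakly-stable size-k committees of E. Then the robustness level of R for elections with 2k+1 candidates and committee size k equals k. -/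
/-- An election with `m` candidates and `n` voters: each voter has a strict linear order on
the candidates, represented by the permutation sending each candidate to its position
(`0`-indexed, so the top-ranked candidate has position `0`). -/
structure Election (m n : ℕ) where
  pref : Fin n → (Fin m ≃ Fin m)

/-- `E'` is obtained from `E` by a single swap of two adjacent candidates in one voter's
preference order. -/
def AdjacentSwap {m n : ℕ} (E E' : Election m n) : Prop :=
  ∃ (v0 : Fin n) (p q : Fin m), (p : ℕ) + 1 = (q : ℕ) ∧
    E'.pref v0 = (E.pref v0).trans (Equiv.swap p q) ∧
    ∀ v : Fin n, v ≠ v0 → E'.pref v = E.pref v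

/-- The number of voters ranking `x` above `y` (smaller position = higher rank). -/
def prefCount {m n : ℕ} (E : Election m n) (x y : Fin m) : ℕ :=
  (Finset.univ.filter (fun v : Fin n => E.pref v x < E.pref v y)).card

/-- A committee `S` is Gehrlein weakly-stable if for every `c ∈ S` and every `d ∉ S`,
at least half of the voters rank `c` above `d`. -/
def WeaklyStable {m n : ℕ} (E : Election m n) (S : Finset (Fin m)) : Prop :=
  ∀ c ∈ S, ∀ d ∉ S, n ≤ 2 * prefCount E c d

/-- The ranking of `Fin m` in which candidate `i` has position `f i`. -/
noncomputable def rankingOfInjOn {m : ℕ} (f : ℕ → ℕ) (hf : ∀ i < m, f i < m)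
    (hinj : ∀ i < m, ∀ j < m, f i = f j → i = j) : Fin m ≃ Fin m :=
  Equiv.ofBijective (fun i => ⟨f i, hf i i.2⟩) <| Finite.injective_iff_bijective.mp
    fun i j h => Fin.ext (hinj i i.2 j j.2 (Fin.mk.inj_iff.mp h))

@[simp]
theorem rankingOfInjOn_apply_val {m : ℕ} (f : ℕ → ℕ) (hf : ∀ i < m, f i < m)
    (hinj : ∀ i < m, ∀ j < m, f i = f j → i = j) (i : Fin m) :
    (rankingOfInjOn f hf hinj i : ℕ) = f i := rfl

/-- The order `k+2 ≻ ⋯ ≻ 2k ≻ k+1 ≻ k-1 ≻ 0 ≻ ⋯ ≻ k-2 ≻ k`, as a position function. -/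
def pivotPos (k i : ℕ) : ℕ :=
  if k + 2 ≤ i then i - (k + 2) else if i = k + 1 then k - 1 else if i = k then 2 * k
  else if i = k - 1 then k else k + 1 + i

/-- The order obtained from `pivotPos` by swapping `k+1` and `k-1`. -/
def pivotPosSwapped (k i : ℕ) : ℕ :=
  if k + 2 ≤ i then i - (k + 2) else if i = k + 1 then k else if i = k then 2 * k
  else if i = k - 1 then k - 1 else k + 1 + i

/-- The order `k+1 ≻ ⋯ ≻ 2k ≻ 0 ≻ ⋯ ≻ k`, as a position function. -/
def rotatedPos (k i : ℕ) : ℕ := if i ≤ k then i + k else i - (k + 1)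

/-- The pivotal voter's ranking. -/
noncomputable def pivotRanking (k : ℕ) (hk : 1 ≤ k) : Fin (2 * k + 1) ≃ Fin (2 * k + 1) :=
  rankingOfInjOn (pivotPos k) (by intro i hi; unfold pivotPos; split_ifs <;> omega)
    (by intro i hi j hj; unfold pivotPos; split_ifs <;> omega)

/-- The pivotal voter's ranking after the swap. -/
noncomputable def pivotRankingSwapped (k : ℕ) (hk : 1 ≤ k) :
    Fin (2 * k + 1) ≃ Fin (2 * k + 1) :=
  rankingOfInjOn (pivotPosSwapped k)
    (by intro i hi; unfold pivotPosSwapped; split_ifs <;> omega)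
    (by intro i hi j hj; unfold pivotPosSwapped; split_ifs <;> omega)

/-- The ranking with position function `rotatedPos`. -/
noncomputable def rotatedRanking (k : ℕ) : Fin (2 * k + 1) ≃ Fin (2 * k + 1) :=
  rankingOfInjOn (rotatedPos k) (by intro i hi; unfold rotatedPos; split_ifs <;> omega)
    (by intro i hi j hj; unfold rotatedPos; split_ifs <;> omega)

/-- Four voters: one with ranking `r`, one with the rotated ranking, two with the identity. -/
noncomputable def fourVoterElection (k : ℕ) (r : Fin (2 * k + 1) ≃ Fin (2 * k + 1)) :
    Election (2 * k + 1) 4 where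
  pref := ![r, Equiv.refl _, rotatedRanking k, Equiv.refl _]

theorem prefCount_fourVoterElection (k : ℕ) (r : Fin (2 * k + 1) ≃ Fin (2 * k + 1))
    (x y : Fin (2 * k + 1)) :
    prefCount (fourVoterElection k r) x y =
      (if (r x : ℕ) < r y then 1 else 0) + (if (x : ℕ) < y then 1 else 0) +
      (if rotatedPos k x < rotatedPos k y then 1 else 0) + (if (x : ℕ) < y then 1 else 0) := by
  rw [prefCount, Finset.card_filter, Fin.sum_univ_four]
  rfl

theorem pivotRankingSwapped_eq (k : ℕ) (hk : 1 ≤ k) :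
    pivotRankingSwapped k hk = (pivotRanking k hk).trans
      (Equiv.swap ⟨k - 1, by omega⟩ ⟨k, by omega⟩) := by
  ext i
  have hi := i.2
  rw [Equiv.trans_apply, Equiv.swap_apply_def, apply_ite Fin.val, apply_ite Fin.val]
  simp only [Fin.ext_iff, pivotRankingSwapped, pivotRanking, rankingOfInjOn_apply_val]
  unfold pivotPos pivotPosSwapped
  split_ifs <;> omega

theorem adjacentSwap_fourVoterElection (k : ℕ) (hk : 1 ≤ k) :
    AdjacentSwap (fourVoterElection k (pivotRanking k hk))
      (fourVoterElection k (pivotRankingSwapped k hk)) := by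
  refine ⟨0, ⟨k - 1, by omega⟩, ⟨k, by omega⟩, by simp; omega, pivotRankingSwapped_eq k hk, ?_⟩
  intro v hv
  fin_cases v
  · exact absurd rfl hv
  all_goals rfl

theorem weaklyStable_Ioi (k : ℕ) (hk : 1 ≤ k) :
    WeaklyStable (fourVoterElection k (pivotRanking k hk))
      (Finset.Ioi (⟨k, by omega⟩ : Fin (2 * k + 1))) := by
  intro c hc d hd
  have hc2 := c.2
  simp only [Finset.mem_Ioi, Fin.lt_def, not_lt] at hc hd
  have h1 : pivotPos k c < pivotPos k d := by unfold pivotPos; split_ifs <;> omega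
  have h2 : rotatedPos k c < rotatedPos k d := by unfold rotatedPos; split_ifs <;> omega
  rw [prefCount_fourVoterElection]
  simp only [pivotRanking, rankingOfInjOn_apply_val, h1, h2, if_true]
  omega

theorem weaklyStable_Iio (k : ℕ) (hk : 1 ≤ k) :
    WeaklyStable (fourVoterElection k (pivotRankingSwapped k hk))
      (Finset.Iio (⟨k, by omega⟩ : Fin (2 * k + 1))) := by
  intro c hc d hd
  simp only [Finset.mem_Iio, Fin.lt_def, not_lt] at hc hd
  have h : (c : ℕ) < d := by omega
  rw [prefCount_fourVoterElection]
  simp only [h, if_true]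
  omega

/-- Stable committees are closed under strict majority defeats. -/
theorem WeaklyStable.mem_of_prefCount_lt {m n : ℕ} {E : Election m n} {S : Finset (Fin m)}
    (hS : WeaklyStable E S) {c d : Fin m} (hc : c ∈ S) (h : 2 * prefCount E c d < n) : d ∈ S := by
  by_contra hd
  exact absurd (hS c hc d hd) (by omega)

theorem two_mul_prefCount_fourVoterElection_lt (k : ℕ) (r : Fin (2 * k + 1) ≃ Fin (2 * k + 1))
    {x y : Fin (2 * k + 1)} (hyx : (y : ℕ) < x)
    (h : (r y : ℕ) < r x ∨ rotatedPos k y < rotatedPos k x) :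
    2 * prefCount (fourVoterElection k r) x y < 4 := by
  rw [prefCount_fourVoterElection]
  simp only [not_lt.mpr hyx.le, if_false]
  rcases h with h | h <;> simp only [not_lt.mpr h.le, if_false] <;> split_ifs <;> omega

theorem le_of_mem_weaklyStable (k : ℕ) (hk : 1 ≤ k) {S : Finset (Fin (2 * k + 1))}
    (hcard : S.card = k) (hS : WeaklyStable (fourVoterElection k (pivotRankingSwapped k hk)) S)
    {a : Fin (2 * k + 1)} (ha : a ∈ S) : (a : ℕ) ≤ k := by
  by_contra! hak
  have ha2 := a.2
  have hx : (⟨k + 1, by omega⟩ : Fin (2 * k + 1)) ∈ S := by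
    by_cases hax : (a : ℕ) = k + 1
    · exact (Fin.ext hax : a = ⟨k + 1, by omega⟩) ▸ ha
    · refine hS.mem_of_prefCount_lt ha (two_mul_prefCount_fourVoterElection_lt _ _ ?_ (.inr ?_))
      · show k + 1 < (a : ℕ)
        omega
      · show rotatedPos k (k + 1) < rotatedPos k a
        unfold rotatedPos
        split_ifs <;> omega
  have hy : (⟨k - 1, by omega⟩ : Fin (2 * k + 1)) ∈ S := by
    refine hS.mem_of_prefCount_lt hx (two_mul_prefCount_fourVoterElection_lt _ _ ?_ (.inl ?_))
    · show k - 1 < k + 1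
      omega
    · show pivotPosSwapped k (k - 1) < pivotPosSwapped k (k + 1)
      unfold pivotPosSwapped
      split_ifs <;> omega
  have hlow : Finset.Iio (⟨k, by omega⟩ : Fin (2 * k + 1)) ⊆ S := by
    intro d hd
    simp only [Finset.mem_Iio, Fin.lt_def] at hd
    by_cases hdy : (d : ℕ) = k - 1
    · exact (Fin.ext hdy : d = ⟨k - 1, by omega⟩) ▸ hy
    · refine hS.mem_of_prefCount_lt hy (two_mul_prefCount_fourVoterElection_lt _ _ ?_ (.inr ?_))
      · show (d : ℕ) < k - 1
        omega
      · show rotatedPos k d < rotatedPos k (k - 1)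
        unfold rotatedPos
        split_ifs <;> omega
  have heq := Finset.eq_of_subset_of_card_le hlow (by simp [hcard])
  rw [← heq, Finset.mem_Iio, Fin.lt_def] at ha
  exact absurd ha (not_lt.mpr hak.le)

theorem statement9 (k : ℕ) (hk : 1 ≤ k)
    (R : (n : ℕ) → Election (2 * k + 1) n → Finset (Finset (Fin (2 * k + 1))))
    (hnonempty : ∀ n (E : Election (2 * k + 1) n), (R n E).Nonempty)
    (hsize : ∀ n (E : Election (2 * k + 1) n), ∀ S ∈ R n E, S.card = k)
    (hgws : ∀ n (E : Election (2 * k + 1) n),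
      (∃ S : Finset (Fin (2 * k + 1)), S.card = k ∧ WeaklyStable E S) →
      ∀ S : Finset (Fin (2 * k + 1)), S ∈ R n E ↔ (S.card = k ∧ WeaklyStable E S)) :
    IsLeast {ℓ : ℕ | ∀ n (E E' : Election (2 * k + 1) n), AdjacentSwap E E' →
      ∀ W ∈ R n E, ∃ W' ∈ R n E', k - ℓ ≤ (W ∩ W').card} k := by
  refine ⟨fun n E E' _ W _ => ?_, fun ℓ hℓ => ?_⟩
  · obtain ⟨W', hW'⟩ := hnonempty n E'
    exact ⟨W', hW', by simp⟩
  · have hIoi : (Finset.Ioi (⟨k, by omega⟩ : Fin (2 * k + 1))).card = k := by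
      rw [Fin.card_Ioi]
      simp
      omega
    have hIio : (Finset.Iio (⟨k, by omega⟩ : Fin (2 * k + 1))).card = k := by simp
    obtain ⟨W', hW', hle⟩ := hℓ 4 _ _ (adjacentSwap_fourVoterElection k hk) _
      ((hgws 4 _ ⟨_, hIoi, weaklyStable_Ioi k hk⟩ _).mpr ⟨hIoi, weaklyStable_Ioi k hk⟩)
    obtain ⟨hcard, hstable⟩ := (hgws 4 _ ⟨_, hIio, weaklyStable_Iio k hk⟩ _).mp hW'
    have hdisj : Finset.Ioi (⟨k, by omega⟩ : Fin (2 * k + 1)) ∩ W' = ∅ := by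
      refine Finset.eq_empty_of_forall_notMem fun a ha => ?_
      rw [Finset.mem_inter, Finset.mem_Ioi, Fin.lt_def] at ha
      exact absurd (le_of_mem_weaklyStable k hk hcard hstable ha.2) (not_le.mpr ha.1)
    rw [hdisj, Finset.card_empty] at hle
    omega
end

section
/- For every k ≥ 1 there exist an election E with 2k candidates and 2k−1 voters and an election E' obtained from E by a single adjacent swap such that E has a unique β-CC winning size-k committee W, E' has a unique β-CC winning size-k committee W', and W ∩ W' = ∅; consequently, the robustness level of the Chamberlin–Courant rule β-CC for elections with 2k candidates and committee size k equals k. -/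
/-- The Chamberlin–Courant (β-CC) score of a committee `S`:
`∑_v max_{c ∈ S} (m − pos_v(c))` with `1`-indexed positions. -/
def ccScore {m n : ℕ} (E : Election m n) (S : Finset (Fin m)) : ℕ :=
  ∑ v : Fin n, S.sup (fun c => m - 1 - (E.pref v c).val)

/-- A size-`k` committee is β-CC winning if no size-`k` committee has strictly greater
β-CC score. -/
def CCWinning {m n : ℕ} (E : Election m n) (k : ℕ) (S : Finset (Fin m)) : Prop :=
  S.card = k ∧ ∀ T : Finset (Fin m), T.card = k → ccScore E T ≤ ccScore E S

theorem exists_perm_apply_pair {α : Type*} [DecidableEq α] {x y p q : α}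
    (hxy : x ≠ y) (hpq : p ≠ q) : ∃ e : α ≃ α, e x = p ∧ e y = q := by
  refine ⟨(Equiv.swap x p).trans (Equiv.swap (Equiv.swap x p y) q), ?_, ?_⟩
  · have h : p ≠ Equiv.swap x p y := by
      intro h
      apply hxy
      apply (Equiv.swap x p).injective
      rw [Equiv.swap_apply_left, ← h]
    simp [Equiv.swap_apply_of_ne_of_ne h hpq]
  · simp

/-- The set of size-`k` committees always contains a winning one. -/
theorem exists_ccWinning {m n k : ℕ} (E : Election m n) (hk : k ≤ m) :
    ∃ W, CCWinning E k W := by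
  have hne : (Finset.powersetCard k (Finset.univ : Finset (Fin m))).Nonempty := by
    rw [Finset.powersetCard_nonempty]
    simpa using hk
  obtain ⟨W, hW, hmax⟩ := Finset.exists_max_image _ (ccScore E) hne
  refine ⟨W, (Finset.mem_powersetCard.1 hW).2, fun T hT => hmax T ?_⟩
  exact Finset.mem_powersetCard.2 ⟨Finset.subset_univ _, hT⟩

section VoterScore

variable {m n : ℕ} (E : Election m n) (S : Finset (Fin m)) {v : Fin n} {a b : Fin m}

theorem voterScore_le_of_top (h : a ∈ S) (ha : (E.pref v a).val = 0) :
    m - 1 ≤ S.sup (fun c => m - 1 - (E.pref v c).val) := by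
  have := Finset.le_sup (f := fun c => m - 1 - (E.pref v c).val) h
  simpa [ha] using this

theorem voterScore_le_of_second (h : b ∈ S) (hb : (E.pref v b).val = 1) :
    m - 2 ≤ S.sup (fun c => m - 1 - (E.pref v c).val) := by
  have := Finset.le_sup (f := fun c => m - 1 - (E.pref v c).val) h
  simp only [hb] at this
  omega

theorem voterScore_le : S.sup (fun c => m - 1 - (E.pref v c).val) ≤ m - 1 :=
  Finset.sup_le fun c _ => by omega

theorem voterScore_le_of_top_notMem (h : a ∉ S) (ha : (E.pref v a).val = 0) :
    S.sup (fun c => m - 1 - (E.pref v c).val) ≤ m - 2 := by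
  refine Finset.sup_le fun c hc => ?_
  have : (E.pref v c).val ≠ 0 := fun h0 =>
    h ((E.pref v).injective (Fin.ext (ha.trans h0.symm)) ▸ hc)
  omega

theorem voterScore_lt_of_notMem (hS : S.Nonempty) (h : a ∉ S) (h' : b ∉ S)
    (ha : (E.pref v a).val = 0) (hb : (E.pref v b).val = 1) :
    S.sup (fun c => m - 1 - (E.pref v c).val) < m - 2 := by
  have key : ∀ c ∈ S, 2 ≤ (E.pref v c).val := by
    intro c hc
    have h0 : (E.pref v c).val ≠ 0 := fun h0 =>
      h ((E.pref v).injective (Fin.ext (ha.trans h0.symm)) ▸ hc)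
    have h1 : (E.pref v c).val ≠ 1 := fun h1 =>
      h' ((E.pref v).injective (Fin.ext (hb.trans h1.symm)) ▸ hc)
    omega
  obtain ⟨c, hc⟩ := hS
  have hc2 := key c hc
  have hlt := (E.pref v c).isLt
  rw [Finset.sup_lt_iff (by rw [Nat.bot_eq_zero]; omega)]
  intro d hd
  have := key d hd
  omega

end VoterScore

/-- Suppose every candidate other than `r` is ranked first by exactly one voter. Viewing each
voter as the edge joining its two best candidates, a size-`k` vertex cover avoiding `r` is the
unique winning committee as soon as it is the only such vertex cover. -/
theorem unique_ccWinning_of_cover {k : ℕ} (hk : 1 ≤ k) (E : Election (2 * k) (2 * k - 1))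
    (t s : Fin (2 * k - 1) → Fin (2 * k)) (r : Fin (2 * k)) (W : Finset (Fin (2 * k)))
    (ht : ∀ v, (E.pref v (t v)).val = 0) (hs : ∀ v, (E.pref v (s v)).val = 1)
    (hinj : Function.Injective t) (hr : ∀ v, t v ≠ r)
    (hW : W.card = k) (hrW : r ∉ W) (hcov : ∀ v, t v ∈ W ∨ s v ∈ W)
    (huniq : ∀ S : Finset (Fin (2 * k)), S.card = k → r ∉ S →
      (∀ v, t v ∈ S ∨ s v ∈ S) → S = W) :
    CCWinning E k W ∧ ∀ S, CCWinning E k S → S = W := by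
  have himg : Finset.univ.image t = Finset.univ.erase r := by
    apply Finset.eq_of_subset_of_card_le
    · intro c hc
      obtain ⟨v, -, rfl⟩ := Finset.mem_image.1 hc
      simp [hr v]
    · rw [Finset.card_image_of_injective _ hinj, Finset.card_erase_of_mem (Finset.mem_univ r)]
      simp
  have hcount : ∀ S : Finset (Fin (2 * k)),
      ∑ v, (if t v ∈ S then 1 else 0) = (S.erase r).card := by
    intro S
    rw [← Finset.card_filter, ← Finset.card_image_of_injective _ hinj]
    congr 1
    ext c
    have hc : c ∈ Finset.univ.image t ↔ c ∈ Finset.univ.erase r := by rw [himg]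
    simp only [Finset.mem_image, Finset.mem_univ, true_and, Finset.mem_erase, and_true] at hc
    simp only [Finset.mem_image, Finset.mem_filter, Finset.mem_univ, true_and, Finset.mem_erase,
      ← hc]
    constructor
    · rintro ⟨v, hv, rfl⟩
      exact ⟨⟨v, rfl⟩, hv⟩
    · rintro ⟨⟨v, rfl⟩, hv⟩
      exact ⟨v, hv, rfl⟩
  have hsum : ∀ S : Finset (Fin (2 * k)),
      ∑ v, (2 * k - 2 + if t v ∈ S then 1 else 0)
        = (2 * k - 1) * (2 * k - 2) + (S.erase r).card := by
    intro S
    rw [Finset.sum_add_distrib, hcount]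
    simp
  have hterm : ∀ (S : Finset (Fin (2 * k))) (v : Fin (2 * k - 1)),
      S.sup (fun c => 2 * k - 1 - (E.pref v c).val)
        ≤ 2 * k - 2 + if t v ∈ S then 1 else 0 := by
    intro S v
    split_ifs with h
    · have := voterScore_le E S (v := v)
      omega
    · exact voterScore_le_of_top_notMem E S h (ht v)
  have hle : ∀ S : Finset (Fin (2 * k)),
      ccScore E S ≤ (2 * k - 1) * (2 * k - 2) + (S.erase r).card := by
    intro S
    rw [← hsum]
    exact Finset.sum_le_sum fun v _ => hterm S v
  have hWscore : (2 * k - 1) * (2 * k - 2) + k ≤ ccScore E W := by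
    have := hsum W
    rw [Finset.erase_eq_of_notMem hrW, hW] at this
    rw [← this]
    refine Finset.sum_le_sum fun v _ => ?_
    split_ifs with h
    · have := voterScore_le_of_top E W h (ht v)
      omega
    · exact voterScore_le_of_second E W ((hcov v).resolve_left h) (hs v)
  refine ⟨⟨hW, fun T hT => ?_⟩, fun S hS => ?_⟩
  · have h1 := hle T
    have h2 := Finset.card_erase_le (s := T) (a := r)
    omega
  · have h1 := hS.2 W hW
    have h2 := hle S
    have hSk := hS.1
    have hrS : r ∉ S := by
      intro h
      have := Finset.card_erase_lt_of_mem h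
      omega
    refine huniq S hSk hrS fun v => ?_
    by_contra! hv
    have hlt : ccScore E S < (2 * k - 1) * (2 * k - 2) + (S.erase r).card := by
      rw [← hsum]
      refine Finset.sum_lt_sum (fun v _ => hterm S v) ⟨v, Finset.mem_univ v, ?_⟩
      rw [if_neg hv.1]
      exact voterScore_lt_of_notMem E S (Finset.card_pos.1 (by omega)) hv.1 hv.2 (ht v) (hs v)
    have := Finset.card_erase_le (s := S) (a := r)
    omega

/-- The two best candidates of the voters form a double star whose centres are the first and the
last candidate. -/
theorem exists_disjoint_unique_ccWinning (k : ℕ) (hk : 1 ≤ k) :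
    ∃ (E E' : Election (2 * k) (2 * k - 1)) (W W' : Finset (Fin (2 * k))),
      AdjacentSwap E E' ∧
      CCWinning E k W ∧ (∀ S, CCWinning E k S → S = W) ∧
      CCWinning E' k W' ∧ (∀ S, CCWinning E' k S → S = W') ∧
      W ∩ W' = ∅ := by
  let z : Fin (2 * k) := ⟨0, by omega⟩
  let o : Fin (2 * k) := ⟨1, by omega⟩
  let l : Fin (2 * k) := ⟨2 * k - 1, by omega⟩
  let v0 : Fin (2 * k - 1) := ⟨0, by omega⟩
  let t : Fin (2 * k - 1) → Fin (2 * k) := fun v => ⟨v.val, by omega⟩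
  let s : Fin (2 * k - 1) → Fin (2 * k) := fun v => if v.val < k then l else z
  have hts : ∀ v, t v ≠ s v := by
    intro v h
    have := congrArg Fin.val h
    have hv := v.isLt
    simp only [t, s] at this
    split_ifs at this <;> simp only [z, l] at this <;> omega
  have hzo : z ≠ o := by simp [z, o]
  have hzl : z ≠ l := by simp only [z, l, ne_eq, Fin.mk.injEq]; omega
  choose f hf0 hf1 using fun v => exists_perm_apply_pair (hts v) hzo
  let E : Election (2 * k) (2 * k - 1) := ⟨f⟩
  let E' : Election (2 * k) (2 * k - 1) :=
    ⟨fun v => if v = v0 then (f v).trans (Equiv.swap z o) else f v⟩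
  let A : Finset (Fin (2 * k)) := Finset.univ.filter fun c => c.val < k
  have hAcard : A.card = k := by
    have : A = Finset.Iio ⟨k, by omega⟩ := by ext c; simp [A, Fin.lt_def]
    rw [this, Fin.card_Iio]
  have hBcard : Aᶜ.card = k := by
    rw [Finset.card_compl, hAcard, Fintype.card_fin]; omega
  have hE := unique_ccWinning_of_cover hk E t s l A
    (fun v => by simp [E, hf0, z]) (fun v => by simp [E, hf1, o])
    (fun v w h => Fin.ext (by simpa [t] using h))
    (fun v h => by
      have := congrArg Fin.val h
      simp only [t, l] at this
      omega)
    hAcard (by simp [A, l]; omega)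
    (fun v => by
      by_cases h : v.val < k
      · simp [A, t, h]
      · right; simp [A, s, h, z]; omega)
    (fun S hS hl hcov => by
      symm
      apply Finset.eq_of_subset_of_card_le _ (by omega)
      intro c hc
      have hc' : c.val < k := by simpa [A] using hc
      have := hcov ⟨c.val, by omega⟩
      simpa [t, s, hc', hl] using this)
  have hE' := unique_ccWinning_of_cover hk E' (fun v => if v = v0 then l else t v)
    (fun v => if v = v0 then z else s v) z Aᶜ
    (fun v => by
      by_cases h : v = v0
      · have h1 := hf1 v0
        have : s v0 = l := by simp [s, v0]; omega
        rw [this] at h1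
        simp [E', h, h1, z]
      · simp [E', h, hf0, z])
    (fun v => by
      by_cases h : v = v0
      · have h1 : f v0 z = z := hf0 v0
        simp [E', h, h1, o]
      · simp [E', h, hf1, o])
    (fun v w h => by
      have hv := v.isLt
      have hw := w.isLt
      have := congrArg Fin.val h
      apply Fin.ext
      dsimp only at this
      split_ifs at this with h1 h2 h2
      · rw [h1, h2]
      all_goals simp only [t, l] at this; omega)
    (fun v h => by
      split_ifs at h with h1
      · exact hzl h.symm
      · exact h1 (Fin.ext (by simpa [t, z] using h)))
    hBcard (by simp [A, z]; omega)
    (fun v => by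
      by_cases h0 : v = v0
      · left; simp [h0, A, l]; omega
      · by_cases h : v.val < k
        · right; simp [A, s, h0, h, l]; omega
        · left; simp [A, t, h0]; omega)
    (fun S hS hz hcov => by
      symm
      apply Finset.eq_of_subset_of_card_le _ (by omega)
      intro c hc
      have hc' : ¬ c.val < k := by simpa [A] using hc
      by_cases hcl : c = l
      · have := hcov v0
        simpa [hz, hcl] using this
      · have hlt : c.val < 2 * k - 1 := by
          have : c.val ≠ 2 * k - 1 := fun h => hcl (Fin.ext h)
          omega
        have hne : (⟨c.val, hlt⟩ : Fin (2 * k - 1)) ≠ v0 := by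
          simp only [v0, ne_eq, Fin.mk.injEq]; omega
        have := hcov ⟨c.val, hlt⟩
        simpa [hne, t, s, hc', hz] using this)
  refine ⟨E, E', A, Aᶜ, ⟨v0, z, o, rfl, by simp [E, E'], fun v hv => by simp [E, E', hv]⟩,
    hE.1, hE.2, hE'.1, hE'.2, Finset.inter_compl A⟩

theorem statement10 (k : ℕ) (hk : 1 ≤ k) :
    (∃ (E E' : Election (2 * k) (2 * k - 1)) (W W' : Finset (Fin (2 * k))),
      AdjacentSwap E E' ∧
      CCWinning E k W ∧ (∀ S, CCWinning E k S → S = W) ∧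
      CCWinning E' k W' ∧ (∀ S, CCWinning E' k S → S = W') ∧
      W ∩ W' = ∅) ∧
    IsLeast {ℓ : ℕ | ∀ n (E E' : Election (2 * k) n), AdjacentSwap E E' →
      ∀ W : Finset (Fin (2 * k)), CCWinning E k W →
        ∃ W' : Finset (Fin (2 * k)), CCWinning E' k W' ∧ k - ℓ ≤ (W ∩ W').card} k := by
  have h := exists_disjoint_unique_ccWinning k hk
  refine ⟨h, fun n E E' _ W _ => ?_, fun ℓ hℓ => ?_⟩
  · obtain ⟨W', hW'⟩ := exists_ccWinning E' (by omega : k ≤ 2 * k)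
    exact ⟨W', hW', by omega⟩
  · obtain ⟨E, E', W, W', hswap, hW, -, -, huniq, hdisj⟩ := h
    obtain ⟨T, hT, hle⟩ := hℓ _ E E' hswap W hW
    rw [huniq T hT, hdisj, Finset.card_empty] at hle
    omega
end

section
/- Fix k ≥ 2 and let C = A ∪ B ∪ {x, y} with A = {a_1, …, a_{k−1}}, B = {b_1, …, b_{k−1}}, all 2k candidates distinct. Consider the election with the following 2k−1 voters: voter v_1 with order x ≻ y ≻ a_1 ≻ ⋯ ≻ a_{k−1} ≻ b_1 ≻ ⋯ ≻ b_{k−1}; and for each i ∈ {1,…,k−1}, voter v_{2i} with order a_i ≻ x ≻ (the candidates of A∖{a_i} in increasing index order) ≻ (the candidates of B in increasing index order) ≻ y, and voter v_{2i+1} with order b_i ≻ y ≻ (the candidates of A in increasing index order) ≻ (the candidates of B∖{b_i} in increasing index order) ≻ x. Then {x} ∪ B is the unique β-CC winning size-k committee of this election, and every other size-k committee has strictly smaller β-CC score. -/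
theorem sum_fin_two_mul_add_one_eq {N n : ℕ} (hN : N = 2 * n + 1) (f : Fin N → ℕ) :
    ∑ v, f v = f ⟨0, by omega⟩ +
      ∑ i : Fin n, (f ⟨2 * i.val + 1, by omega⟩ + f ⟨2 * i.val + 2, by omega⟩) := by
  subst hN
  induction n with
  | zero => simp
  | succ n ih =>
    change ∑ v : Fin (2 * n + 1 + 1 + 1), f v = _
    rw [Fin.sum_univ_castSucc (n := 2 * n + 2), Fin.sum_univ_castSucc (n := 2 * n + 1),
      ih (fun v => f v.castSucc.castSucc), Fin.sum_univ_castSucc (n := n)]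
    simp only [add_assoc]
    rfl

theorem Equiv.val_pos_of_ne {m : ℕ} (e : Fin m ≃ Fin m) {t c : Fin m} (ht : (e t).val = 0)
    (hc : c ≠ t) : 1 ≤ (e c).val := by
  have h : (e c).val ≠ (e t).val := fun h => hc (e.injective (Fin.ext h))
  omega

/-- A committee without the top candidate `t` of a voter leaves at least one point. -/
theorem sup_score_le_sub_one {m : ℕ} (e : Fin m ≃ Fin m) {t : Fin m} (T : Finset (Fin m))
    (ht : (e t).val = 0) (htT : t ∉ T) :
    T.sup (fun c => m - 1 - (e c).val) ≤ m - 2 := by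
  refine Finset.sup_le fun c hc => ?_
  have := e.val_pos_of_ne ht (ne_of_mem_of_not_mem hc htT)
  omega

/-- A committee without the two best candidates of a voter leaves at least two points. -/
theorem sup_score_le_sub_two {m : ℕ} (e : Fin m ≃ Fin m) {t u : Fin m} (T : Finset (Fin m))
    (ht : (e t).val = 0) (hu : (e u).val = 1) (htT : t ∉ T) (huT : u ∉ T) :
    T.sup (fun c => m - 1 - (e c).val) ≤ m - 3 := by
  refine Finset.sup_le fun c hc => ?_
  have := e.val_pos_of_ne ht (ne_of_mem_of_not_mem hc htT)
  have h : (e c).val ≠ (e u).val :=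
    fun h => ne_of_mem_of_not_mem hc huT (e.injective (Fin.ext h))
  omega

theorem sup_score_le {m : ℕ} (e : Fin m ≃ Fin m) (T : Finset (Fin m)) :
    T.sup (fun c => m - 1 - (e c).val) ≤ m - 1 :=
  Finset.sup_le fun _ _ => Nat.sub_le _ _

theorem Finset.sum_ite_mem_le_card_of_injective {ι α : Type*} [Fintype ι] [DecidableEq α]
    {g : ι → α} (hg : Function.Injective g) (T : Finset α) :
    ∑ j, (if g j ∈ T then 1 else 0) ≤ T.card := by
  rw [← Finset.card_filter]
  exact Finset.card_le_card_of_injOn g (by intro j hj; simpa using hj) hg.injOn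

/-- The election has `2k` candidates `x`, `y`, `a 0, …, a (k-2)`, `b 0, …, b (k-2)`
(`a i` and `b i` stand for the paper's `a_{i+1}` and `b_{i+1}`), and `2k − 1` voters:
voter `0` is `v₁`, voter `2i+1` is `v_{2(i+1)}`, and voter `2i+2` is `v_{2(i+1)+1}`.
All positions below are `0`-indexed. -/
theorem statement11 (k : ℕ) (hk : 2 ≤ k)
    (E : Election (2 * k) (2 * k - 1))
    (x y : Fin (2 * k)) (a b : Fin (k - 1) → Fin (2 * k))
    -- voter v₁ : x ≻ y ≻ A ≻ B
    (h1x : (E.pref ⟨0, by omega⟩ x).val = 0)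
    (h1y : (E.pref ⟨0, by omega⟩ y).val = 1)
    (h1a : ∀ i : Fin (k - 1), (E.pref ⟨0, by omega⟩ (a i)).val = 2 + i.val)
    (h1b : ∀ i : Fin (k - 1), (E.pref ⟨0, by omega⟩ (b i)).val = k + 1 + i.val)
    -- voter v_{2(i+1)} : a i ≻ x ≻ A∖{a i} (incr. index) ≻ B (incr. index) ≻ y
    (h2a : ∀ i : Fin (k - 1),
      (E.pref ⟨2 * i.val + 1, by have := i.isLt; omega⟩ (a i)).val = 0)
    (h2x : ∀ i : Fin (k - 1),
      (E.pref ⟨2 * i.val + 1, by have := i.isLt; omega⟩ x).val = 1)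
    (h2alt : ∀ i j : Fin (k - 1), j < i →
      (E.pref ⟨2 * i.val + 1, by have := i.isLt; omega⟩ (a j)).val = 2 + j.val)
    (h2agt : ∀ i j : Fin (k - 1), i < j →
      (E.pref ⟨2 * i.val + 1, by have := i.isLt; omega⟩ (a j)).val = 1 + j.val)
    (h2b : ∀ i j : Fin (k - 1),
      (E.pref ⟨2 * i.val + 1, by have := i.isLt; omega⟩ (b j)).val = k + j.val)
    (h2y : ∀ i : Fin (k - 1),
      (E.pref ⟨2 * i.val + 1, by have := i.isLt; omega⟩ y).val = 2 * k - 1)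
    -- voter v_{2(i+1)+1} : b i ≻ y ≻ A (incr. index) ≻ B∖{b i} (incr. index) ≻ x
    (h3b : ∀ i : Fin (k - 1),
      (E.pref ⟨2 * i.val + 2, by have := i.isLt; omega⟩ (b i)).val = 0)
    (h3y : ∀ i : Fin (k - 1),
      (E.pref ⟨2 * i.val + 2, by have := i.isLt; omega⟩ y).val = 1)
    (h3a : ∀ i j : Fin (k - 1),
      (E.pref ⟨2 * i.val + 2, by have := i.isLt; omega⟩ (a j)).val = 2 + j.val)
    (h3blt : ∀ i j : Fin (k - 1), j < i →
      (E.pref ⟨2 * i.val + 2, by have := i.isLt; omega⟩ (b j)).val = k + 1 + j.val)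
    (h3bgt : ∀ i j : Fin (k - 1), i < j →
      (E.pref ⟨2 * i.val + 2, by have := i.isLt; omega⟩ (b j)).val = k + j.val)
    (h3x : ∀ i : Fin (k - 1),
      (E.pref ⟨2 * i.val + 2, by have := i.isLt; omega⟩ x).val = 2 * k - 1) :
    CCWinning E k (insert x (Finset.image b Finset.univ)) ∧
    ∀ T : Finset (Fin (2 * k)), T.card = k →
      T ≠ insert x (Finset.image b Finset.univ) →
      ccScore E T < ccScore E (insert x (Finset.image b Finset.univ)) := by
  have hinj : Function.Injective
      (Sum.elim (Sum.elim a b) (fun t : Bool => if t then x else y)) := by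
    intro p q hpq
    have h := congrArg (fun c => (E.pref ⟨0, by omega⟩ c).val) hpq
    rcases p with (i | i) | (_ | _) <;> rcases q with (j | j) | (_ | _) <;>
      simp only [Sum.elim_inl, Sum.elim_inr, h1x, h1y, h1a, h1b, if_true, if_false,
        Bool.false_eq_true] at h <;> first
      | rfl
      | (obtain rfl : i = j := Fin.ext (by omega)
         rfl)
      | omega
  have hb_inj : Function.Injective b := fun i j h => by
    simpa using @hinj (.inl (.inr i)) (.inl (.inr j)) h
  have hcard : (insert x (Finset.image b Finset.univ)).card = k := by
    rw [Finset.card_insert_of_notMem, Finset.card_image_of_injective _ hb_inj,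
      Finset.card_univ, Fintype.card_fin]
    · omega
    · simp only [Finset.mem_image, Finset.mem_univ, true_and, not_exists]
      rintro i rfl
      have := h1b i
      omega
  have hT_lt : ∀ T : Finset (Fin (2 * k)), T.card = k →
      T ≠ insert x (Finset.image b Finset.univ) →
      ccScore E T < ccScore E (insert x (Finset.image b Finset.univ)) := by
    intro T hT hne
    have hN : 2 * k - 1 = 2 * (k - 1) + 1 := by omega
    have hlower : (2 * k - 1) + (k - 1) * (4 * k - 3) ≤
        ccScore E (insert x (Finset.image b Finset.univ)) := by
      unfold ccScore
      rw [sum_fin_two_mul_add_one_eq hN]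
      refine add_le_add ?_ ?_
      · refine le_trans ?_ (Finset.le_sup (Finset.mem_insert_self x _))
        rw [h1x]; omega
      · have hterm : ∀ i ∈ (Finset.univ : Finset (Fin (k - 1))), 4 * k - 3 ≤
            (insert x (Finset.image b Finset.univ)).sup (fun c => 2 * k - 1 -
              (E.pref ⟨2 * i.val + 1, by have := i.isLt; omega⟩ c).val) +
            (insert x (Finset.image b Finset.univ)).sup (fun c => 2 * k - 1 -
              (E.pref ⟨2 * i.val + 2, by have := i.isLt; omega⟩ c).val) := by
          intro i _
          have hx := Finset.le_sup (f := fun c => 2 * k - 1 -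
              (E.pref ⟨2 * i.val + 1, by have := i.isLt; omega⟩ c).val)
              (Finset.mem_insert_self x (Finset.image b Finset.univ))
          have hb := Finset.le_sup (f := fun c => 2 * k - 1 -
              (E.pref ⟨2 * i.val + 2, by have := i.isLt; omega⟩ c).val)
              (Finset.mem_insert_of_mem (b := x)
                (Finset.mem_image_of_mem b (Finset.mem_univ i)))
          simp only [h2x, h3b] at hx hb
          omega
        have := Finset.card_nsmul_le_sum _ _ _ hterm
        simpa using this
    refine lt_of_lt_of_le ?_ hlower
    have hcount : ((∑ i, if a i ∈ T then 1 else 0) + ∑ i, if b i ∈ T then 1 else 0) +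
        ((if x ∈ T then 1 else 0) + if y ∈ T then 1 else 0) ≤ k := by
      have := Finset.sum_ite_mem_le_card_of_injective hinj T
      rw [Fintype.sum_sum_type, Fintype.sum_sum_type, Fintype.sum_bool, hT] at this
      exact this
    rw [← Finset.sum_add_distrib] at hcount
    unfold ccScore
    rw [sum_fin_two_mul_add_one_eq hN]
    have hterm : ∀ i : Fin (k - 1),
        T.sup (fun c => 2 * k - 1 -
          (E.pref ⟨2 * i.val + 1, by have := i.isLt; omega⟩ c).val) +
        T.sup (fun c => 2 * k - 1 -
          (E.pref ⟨2 * i.val + 2, by have := i.isLt; omega⟩ c).val) ≤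
        (4 * k - 4) + ((if a i ∈ T then 1 else 0) + if b i ∈ T then 1 else 0) := by
      intro i
      have hA := sup_score_le (E.pref ⟨2 * i.val + 1, by have := i.isLt; omega⟩) T
      have hB := sup_score_le (E.pref ⟨2 * i.val + 2, by have := i.isLt; omega⟩) T
      have hA' := sup_score_le_sub_one _ T (h2a i)
      have hB' := sup_score_le_sub_one _ T (h3b i)
      split_ifs with ha hb hb
      · omega
      · have := hB' hb; omega
      · have := hA' ha; omega
      · have := hA' ha; have := hB' hb; omega
    have hsum := Finset.sum_le_sum fun i (_ : i ∈ Finset.univ) => hterm i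
    have hdistrib : ∑ i : Fin (k - 1),
        ((4 * k - 4) + ((if a i ∈ T then 1 else 0) + if b i ∈ T then 1 else 0)) =
        (k - 1) * (4 * k - 4) +
          ∑ i, ((if a i ∈ T then 1 else 0) + if b i ∈ T then 1 else 0) := by
      rw [Finset.sum_add_distrib, Finset.sum_const, Finset.card_univ, Fintype.card_fin,
        smul_eq_mul]
    rw [hdistrib] at hsum
    have hmul : (k - 1) * (4 * k - 3) = (k - 1) * (4 * k - 4) + (k - 1) := by
      rw [show 4 * k - 3 = (4 * k - 4) + 1 by omega]; ring
    have h0 := sup_score_le (E.pref ⟨0, by omega⟩) T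
    have h0' := sup_score_le_sub_one _ T h1x
    have h0'' := sup_score_le_sub_two _ T h1x h1y
    by_cases hx : x ∈ T
    · by_cases hy : y ∈ T
      · simp only [hx, hy, if_true] at hcount
        omega
      · obtain ⟨j, hj⟩ : ∃ j, b j ∉ T := by
          by_contra! hall
          refine hne (Finset.eq_of_subset_of_card_le ?_ ?_).symm
          · intro c hc
            simp only [Finset.mem_insert, Finset.mem_image, Finset.mem_univ, true_and] at hc
            rcases hc with rfl | ⟨j, rfl⟩
            exacts [hx, hall j]
          · rw [hcard, hT]
        simp only [hx, hy, if_true, if_false] at hcount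
        have hlt := Finset.sum_lt_sum (fun i (_ : i ∈ Finset.univ) => hterm i)
          ⟨j, Finset.mem_univ j, by
            have hA := sup_score_le (E.pref ⟨2 * j.val + 1, by have := j.isLt; omega⟩) T
            have hA' := sup_score_le_sub_one _ T (h2a j)
            have hB := sup_score_le_sub_two _ T (h3b j) (h3y j) hj hy
            split_ifs with ha
            · omega
            · have := hA' ha; omega⟩
        rw [hdistrib] at hlt
        omega
    · by_cases hy : y ∈ T
      · have := h0' hx
        simp only [hx, hy, if_true, if_false] at hcount
        omega
      · have := h0'' hx hy
        simp only [hx, hy, if_false] at hcount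
        omega
  refine ⟨⟨hcard, fun T hT => ?_⟩, hT_lt⟩
  by_cases h : T = insert x (Finset.image b Finset.univ)
  · rw [h]
  · exact (hT_lt T hT h).le
end

section
/- For every committee size k ≥ 1 and every ℓ with 1 ≤ ℓ ≤ k, there exist a number m of candidates and a multiwinner rule R, assigning to each election with m candidates a nonempty family of size-k committees, whose robustness level for elections with m candidates and committee size k is exactly ℓ. -/
/-- The first `k` of `k + ℓ` candidates. -/
def lowCommittee (k ℓ : ℕ) : Finset (Fin (k + ℓ)) :=
  Finset.univ.map (Fin.castAddEmb ℓ)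

/-- The last `k` of `k + ℓ` candidates. -/
def highCommittee (k ℓ : ℕ) : Finset (Fin (k + ℓ)) :=
  Finset.univ.filter fun i => ℓ ≤ (i : ℕ)

theorem card_lowCommittee (k ℓ : ℕ) : (lowCommittee k ℓ).card = k := by
  simp [lowCommittee]

theorem card_filter_val {m : ℕ} (p : ℕ → Prop) [DecidablePred p] :
    (Finset.univ.filter fun i : Fin m => p i).card = ((Finset.range m).filter p).card := by
  rw [← Fin.map_valEmbedding_univ.trans (Nat.Iio_eq_range m), Finset.filter_map, Finset.card_map]
  rfl

theorem card_highCommittee (k ℓ : ℕ) : (highCommittee k ℓ).card = k := by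
  have h : (Finset.range (k + ℓ)).filter (ℓ ≤ ·) = Finset.Ico ℓ (k + ℓ) := by
    ext i
    simp [and_comm]
  rw [highCommittee, card_filter_val, h, Nat.card_Ico, Nat.add_sub_cancel]

theorem card_lowCommittee_inter_highCommittee (k ℓ : ℕ) :
    (lowCommittee k ℓ ∩ highCommittee k ℓ).card = k - ℓ := by
  have h : lowCommittee k ℓ ∩ highCommittee k ℓ =
      Finset.univ.filter fun i : Fin (k + ℓ) => ℓ ≤ (i : ℕ) ∧ (i : ℕ) < k := by
    ext i
    simp only [lowCommittee, highCommittee, Finset.mem_inter, Finset.mem_map, Finset.mem_filter,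
      Finset.mem_univ, true_and, Fin.castAddEmb_apply]
    constructor
    · rintro ⟨⟨a, rfl⟩, h⟩
      exact ⟨h, a.isLt⟩
    · rintro ⟨h, hi⟩
      exact ⟨⟨⟨i, hi⟩, rfl⟩, h⟩
  have h' : (Finset.range (k + ℓ)).filter (fun i => ℓ ≤ i ∧ i < k) = Finset.Ico ℓ k := by
    ext i
    simp only [Finset.mem_filter, Finset.mem_range, Finset.mem_Ico]
    omega
  rw [h, card_filter_val fun i => ℓ ≤ i ∧ i < k, h', Nat.card_Ico]

open Classical in
/-- The committee `lowCommittee k ℓ` wins if every voter ranks the candidates in their natural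
order, and `highCommittee k ℓ` wins otherwise. -/
noncomputable def consensusWinner (k ℓ n : ℕ) (E : Election (k + ℓ) n) : Finset (Fin (k + ℓ)) :=
  if ∀ v, E.pref v = Equiv.refl _ then lowCommittee k ℓ else highCommittee k ℓ

theorem consensusWinner_eq_or (k ℓ n : ℕ) (E : Election (k + ℓ) n) :
    consensusWinner k ℓ n E = lowCommittee k ℓ ∨ consensusWinner k ℓ n E = highCommittee k ℓ := by
  unfold consensusWinner
  split_ifs <;> simp

theorem le_card_consensusWinner_inter (k ℓ n : ℕ) (E E' : Election (k + ℓ) n) :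
    k - ℓ ≤ (consensusWinner k ℓ n E ∩ consensusWinner k ℓ n E').card := by
  rcases consensusWinner_eq_or k ℓ n E with h | h <;>
    rcases consensusWinner_eq_or k ℓ n E' with h' | h' <;> rw [h, h']
  · simp [card_lowCommittee]
  · rw [card_lowCommittee_inter_highCommittee]
  · rw [Finset.inter_comm, card_lowCommittee_inter_highCommittee]
  · simp [card_highCommittee]

theorem exists_adjacentSwap_consensusWinner {k ℓ : ℕ} (h : 2 ≤ k + ℓ) :
    ∃ E E' : Election (k + ℓ) 1, AdjacentSwap E E' ∧
      consensusWinner k ℓ 1 E = lowCommittee k ℓ ∧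
      consensusWinner k ℓ 1 E' = highCommittee k ℓ := by
  let p : Fin (k + ℓ) := ⟨0, by omega⟩
  let q : Fin (k + ℓ) := ⟨1, by omega⟩
  have hpq : p ≠ q := by simp [p, q]
  refine ⟨⟨fun _ => Equiv.refl _⟩, ⟨fun _ => Equiv.swap p q⟩, ⟨0, p, q, rfl, rfl, ?_⟩, ?_, ?_⟩
  · intro v hv
    exact absurd (Subsingleton.elim v 0) hv
  · exact if_pos fun _ => rfl
  · exact if_neg fun hE => hpq (Equiv.swap_eq_refl_iff.mp (hE 0))

theorem statement12 (k ℓ : ℕ) (hk : 1 ≤ k) (hℓ : 1 ≤ ℓ) (hℓk : ℓ ≤ k) :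
    ∃ (m : ℕ) (R : (n : ℕ) → Election m n → Finset (Finset (Fin m))),
      (∀ n (E : Election m n), (R n E).Nonempty) ∧
      (∀ n (E : Election m n), ∀ S ∈ R n E, S.card = k) ∧
      IsLeast {ℓ' : ℕ | ∀ n (E E' : Election m n), AdjacentSwap E E' →
        ∀ W ∈ R n E, ∃ W' ∈ R n E', k - ℓ' ≤ (W ∩ W').card} ℓ := by
  refine ⟨k + ℓ, fun n E => {consensusWinner k ℓ n E}, fun n E => Finset.singleton_nonempty _,
    fun n E S hS => ?_, fun n E E' _ W hW => ?_, fun ℓ' h => ?_⟩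
  · rw [Finset.mem_singleton.mp hS]
    rcases consensusWinner_eq_or k ℓ n E with h | h <;> rw [h]
    exacts [card_lowCommittee k ℓ, card_highCommittee k ℓ]
  · rw [Finset.mem_singleton.mp hW]
    exact ⟨_, Finset.mem_singleton_self _, le_card_consensusWinner_inter k ℓ n E E'⟩
  · obtain ⟨E, E', hswap, hE, hE'⟩ := exists_adjacentSwap_consensusWinner (by omega : 2 ≤ k + ℓ)
    obtain ⟨W', hW', hcard⟩ := h 1 E E' hswap _ (Finset.mem_singleton_self _)
    rw [Finset.mem_singleton.mp hW', hE, hE', card_lowCommittee_inter_highCommittee] at hcard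
    omega
end

section
/- Let W_A and W_B be two β-CC winning size-k committees of an election E, and suppose there is a voter v whose highest-ranked member of W_A differs from v's highest-ranked member of W_B. Then there exists an election E' obtained from E by a single adjacent swap such that at least one of W_A and W_B is not β-CC winning in E'; in particular, the set of β-CC winning size-k committees of E' differs from that of E. -/
/-- `c` is voter `v`'s representative under committee `S`: the highest-ranked
(smallest-position) member of `S` in `v`'s order. -/
def IsRep {m n : ℕ} (E : Election m n) (v : Fin n) (S : Finset (Fin m)) (c : Fin m) : Prop :=
  c ∈ S ∧ ∀ c' ∈ S, E.pref v c ≤ E.pref v c'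

/-- Moving the lower-ranked of two distinct representatives up by one position strictly raises
the score of its committee and does not raise the score of the other, so the other committee
stops winning. -/
theorem exists_adjacentSwap_not_ccWinning {m n k : ℕ} (E : Election m n)
    (WA WB : Finset (Fin m)) (hA : CCWinning E k WA) (hB : CCWinning E k WB)
    (v : Fin n) (cA cB : Fin m) (hcA : IsRep E v WA cA) (hcB : IsRep E v WB cB)
    (hlt : E.pref v cA < E.pref v cB) :
    ∃ E' : Election m n, AdjacentSwap E E' ∧ ¬ CCWinning E' k WA := by
  have hlt' : (E.pref v cA).val < (E.pref v cB).val := hlt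
  obtain ⟨q, hq⟩ : ∃ q, q = E.pref v cB := ⟨_, rfl⟩
  obtain ⟨p, hp⟩ : ∃ p : Fin m, (p : ℕ) + 1 = q :=
    ⟨⟨q - 1, by omega⟩, by simp only; omega⟩
  let E' : Election m n := ⟨Function.update E.pref v ((E.pref v).trans (Equiv.swap p q))⟩
  have hv : E'.pref v = (E.pref v).trans (Equiv.swap p q) := Function.update_self ..
  have hother : ∀ w, w ≠ v → E'.pref w = E.pref w := fun w hw => Function.update_of_ne hw ..
  refine ⟨E', ⟨v, p, q, hp, hv, hother⟩, fun hwin => ?_⟩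
  have hAle : ccScore E' WA ≤ ccScore E WA := by
    refine Finset.sum_le_sum fun w _ => ?_
    obtain rfl | hw := eq_or_ne w v
    · refine le_trans (Finset.sup_le fun c hc => ?_)
        (Finset.le_sup (f := fun c => m - 1 - (E.pref w c).val) hcA.1)
      have hpos : (E.pref w cA).val ≤ (E.pref w c).val := hcA.2 c hc
      rw [hv, Equiv.trans_apply, Equiv.swap_apply_def]
      split_ifs with h1 h2
      · rw [h1] at hpos
        omega
      · omega
      · omega
    · rw [hother w hw]
  have hvlt : WB.sup (fun c => m - 1 - (E.pref v c).val) <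
      WB.sup (fun c => m - 1 - (E'.pref v c).val) := by
    refine lt_of_le_of_lt (b := m - 1 - (q : ℕ)) (Finset.sup_le fun c hc => ?_)
      (lt_of_lt_of_le ?_ (Finset.le_sup (f := fun c => m - 1 - (E'.pref v c).val) hcB.1))
    · have hpos : (E.pref v cB).val ≤ (E.pref v c).val := hcB.2 c hc
      rw [hq]
      omega
    · rw [hv, Equiv.trans_apply, ← hq, Equiv.swap_apply_right]
      omega
  have hBlt : ccScore E WB < ccScore E' WB := by
    refine Finset.sum_lt_sum (fun w _ => ?_) ⟨v, Finset.mem_univ v, hvlt⟩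
    obtain rfl | hw := eq_or_ne w v
    · exact hvlt.le
    · rw [hother w hw]
  exact absurd (hwin.2 WB hB.1) (not_le.2 ((hAle.trans (hB.2 WA hA.1)).trans_lt hBlt))

theorem statement14 {m n k : ℕ} (E : Election m n) (WA WB : Finset (Fin m))
    (hA : CCWinning E k WA) (hB : CCWinning E k WB)
    (v : Fin n) (cA cB : Fin m)
    (hcA : IsRep E v WA cA) (hcB : IsRep E v WB cB) (hne : cA ≠ cB) :
    ∃ E' : Election m n, AdjacentSwap E E' ∧
      (¬ CCWinning E' k WA ∨ ¬ CCWinning E' k WB) ∧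
      {S : Finset (Fin m) | CCWinning E' k S} ≠ {S : Finset (Fin m) | CCWinning E k S} := by
  rcases lt_or_gt_of_ne ((E.pref v).injective.ne hne) with hlt | hlt
  · obtain ⟨E', hswap, hnot⟩ :=
      exists_adjacentSwap_not_ccWinning E WA WB hA hB v cA cB hcA hcB hlt
    exact ⟨E', hswap, Or.inl hnot, fun h => hnot (h.symm.subset hA)⟩
  · obtain ⟨E', hswap, hnot⟩ :=
      exists_adjacentSwap_not_ccWinning E WB WA hB hA v cB cA hcB hcA hlt
    exact ⟨E', hswap, Or.inr hnot, fun h => hnot (h.symm.subset hB)⟩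
end

section
/- Let W_A ≠ W_B be two β-CC winning size-k committees of an election E such that every voter's highest-ranked member of W_A coincides with that voter's highest-ranked member of W_B. Then for every voter v, v's highest-ranked member of W_A is v's top-ranked candidate. -/
theorem exists_isRep {m n : ℕ} (E : Election m n) (v : Fin n) {S : Finset (Fin m)}
    (hS : S.Nonempty) : ∃ c, IsRep E v S c :=
  S.exists_min_image (fun c => E.pref v c) hS

theorem IsRep.sup_eq {m n : ℕ} {E : Election m n} {v : Fin n} {S : Finset (Fin m)} {c : Fin m}
    (h : IsRep E v S c) :
    S.sup (fun c => m - 1 - (E.pref v c).val) = m - 1 - (E.pref v c).val := by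
  refine le_antisymm (Finset.sup_le fun c' hc' => ?_)
    (Finset.le_sup (f := fun c => m - 1 - (E.pref v c).val) h.1)
  have := Fin.le_def.1 (h.2 c' hc')
  omega

theorem statement15 {m n k : ℕ} (E : Election m n) (WA WB : Finset (Fin m))
    (hA : CCWinning E k WA) (hB : CCWinning E k WB) (hne : WA ≠ WB)
    (hsame : ∀ v : Fin n, ∀ cA cB : Fin m,
      IsRep E v WA cA → IsRep E v WB cB → cA = cB) :
    ∀ v : Fin n, ∀ cA : Fin m, IsRep E v WA cA → (E.pref v cA).val = 0 := by
  intro v cA hv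
  by_contra hpos
  have hcard : WB.card = WA.card := hB.1.trans hA.1.symm
  obtain ⟨a, haA, haB⟩ : ∃ a ∈ WA, a ∉ WB := by
    by_contra! hsub
    exact hne (Finset.eq_of_subset_of_card_le hsub hcard.le)
  have hneA : WA.Nonempty := ⟨a, haA⟩
  have hneB : WB.Nonempty := Finset.card_pos.1 (hcard ▸ Finset.card_pos.2 hneA)
  have hrep_ne : ∀ u c, IsRep E u WA c → c ≠ a := by
    rintro u c hc rfl
    obtain ⟨b, hb⟩ := exists_isRep E u hneB
    exact haB (hsame u c b hc hb ▸ hb.1)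
  have hm : 0 < m := a.pos
  obtain ⟨t, ht⟩ := (E.pref v).surjective ⟨0, hm⟩
  have ht0 : (E.pref v t).val = 0 := by rw [ht]
  have htA : t ∉ WA := by
    intro h
    have := Fin.le_def.1 (hv.2 t h)
    omega
  have hTcard : (insert t (WA.erase a)).card = k := by
    rw [Finset.card_insert_of_notMem (fun h => htA (Finset.mem_of_mem_erase h)),
      Finset.card_erase_add_one haA, hA.1]
  refine (hA.2 _ hTcard).not_gt (Finset.sum_lt_sum (fun u _ => ?_) ⟨v, Finset.mem_univ v, ?_⟩)
  · obtain ⟨c, hc⟩ := exists_isRep E u hneA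
    rw [hc.sup_eq]
    exact Finset.le_sup (f := fun c => m - 1 - (E.pref u c).val)
      (Finset.mem_insert_of_mem (Finset.mem_erase.2 ⟨hrep_ne u c hc, hc.1⟩))
  · rw [hv.sup_eq]
    refine lt_of_lt_of_le ?_ (Finset.le_sup (f := fun c => m - 1 - (E.pref v c).val)
      (Finset.mem_insert_self t (WA.erase a)))
    have := (E.pref v cA).isLt
    simp only [ht0]
    omega
end
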